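/- arXiv:2501.17882 — 2 statements merged into one kernel-verified Lean document; each statement's English description precedes it below -/
import Mathlib

section
/- Let K < M be positive integers. For each player k ∈ {1,…,K} and arm m ∈ {1,…,M}, let μ_k(m) ∈ [0,1] be the true mean reward and μ̂_k(m) ∈ [0,1] an estimated mean reward. An assignment is an injective function a : {1,…,K} → {1,…,M}. Let J₁ = max over assignments a of Σ_{k=1}^K μ_k(a(k)), suppose this maximum is attained at a unique assignment a*, let J₂ = max over assignments a ≠ a* of Σ_{k=1}^K μ_k(a(k)), and set Δ = (J₁ − J₂)/(2M). If |μ̂_k(m) − μ_k(m)| ≤ Δ for all k and m, then a* is also the unique maximizer of Σ_{k=1}^K μ̂_k(a(k)) over all assignments a. -/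
/-- Let `K < M` be positive integers, `μ k m ∈ [0,1]` the true mean rewards and
`μhat k m ∈ [0,1]` the estimated mean rewards. An assignment is an injective function
`a : Fin K → Fin M`. Let `J₁` be the maximum of `∑ k, μ k (a k)` over assignments,
attained at the unique assignment `astar`, let `J₂` be the maximum over assignments
`a ≠ astar`, and set `Δ = (J₁ − J₂)/(2M)`. If `|μhat k m − μ k m| ≤ Δ` for all `k, m`,
then `astar` is also the unique maximizer of `∑ k, μhat k (a k)` over assignments. -/
theorem stmt_0 (K M : ℕ) (hK : 0 < K) (hKM : K < M)
    (μ μhat : Fin K → Fin M → ℝ)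
    (hμ : ∀ k m, μ k m ∈ Set.Icc (0 : ℝ) 1)
    (hμhat : ∀ k m, μhat k m ∈ Set.Icc (0 : ℝ) 1)
    (astar : Fin K → Fin M) (hinj : Function.Injective astar)
    (huniq : ∀ a : Fin K → Fin M, Function.Injective a → a ≠ astar →
      ∑ k, μ k (a k) < ∑ k, μ k (astar k))
    (J₁ J₂ Δ : ℝ)
    (hJ₁ : J₁ = ∑ k, μ k (astar k))
    (hJ₂ : IsGreatest {x : ℝ | ∃ a : Fin K → Fin M,
      Function.Injective a ∧ a ≠ astar ∧ x = ∑ k, μ k (a k)} J₂)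
    (hΔ : Δ = (J₁ - J₂) / (2 * M))
    (hest : ∀ k m, |μhat k m - μ k m| ≤ Δ) :
    ∀ a : Fin K → Fin M, Function.Injective a → a ≠ astar →
      ∑ k, μhat k (a k) < ∑ k, μhat k (astar k) := by
  intro a ha hne
  obtain ⟨⟨b, hb, hbne, hbe⟩, hub⟩ := hJ₂
  have h1 : J₂ < J₁ := by rw [hJ₁, hbe]; exact huniq b hb hbne
  have h2 : ∑ k, μ k (a k) ≤ J₂ := hub ⟨a, ha, hne, rfl⟩
  have hKM' : (K : ℝ) < M := by exact_mod_cast hKM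
  have hM : (0 : ℝ) < M := lt_of_le_of_lt (Nat.cast_nonneg K) hKM'
  have hD : J₁ - J₂ = 2 * M * Δ := by rw [hΔ]; field_simp
  have hΔpos : 0 < Δ := by rw [hΔ]; exact div_pos (by linarith) (by linarith)
  have h3 : ∑ k, μhat k (a k) ≤ ∑ k, (μ k (a k) + Δ) :=
    Finset.sum_le_sum fun k _ => by linarith [(abs_le.mp (hest k (a k))).2]
  have h4 : ∑ k, (μ k (astar k) - Δ) ≤ ∑ k, μhat k (astar k) :=
    Finset.sum_le_sum fun k _ => by linarith [(abs_le.mp (hest k (astar k))).1]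
  simp only [Finset.sum_add_distrib, Finset.sum_sub_distrib, Finset.sum_const,
    Finset.card_univ, Fintype.card_fin, nsmul_eq_mul] at h3 h4
  have h5 : (K : ℝ) * Δ < M * Δ := mul_lt_mul_of_pos_right hKM' hΔpos
  linarith
end

section
/- Let K < M be positive integers and let μ̂_k(m) ∈ (0,1] for every player k ∈ {1,…,K} and arm m ∈ {1,…,M}. For a function a : {1,…,K} → {1,…,M} and an attack vector w ∈ {0,1}^M, define the utility u_k(a,w) = μ̂_k(a(k)) if no other player chooses arm a(k) and w_{a(k)} = 0, and u_k(a,w) = 0 otherwise. Let a* be an injective function maximizing Σ_{k=1}^K μ̂_k(a(k)) over injective functions, and let w⁰ = (0,…,0). Then for every function a and every w ∈ {0,1}^M: Σ_{k=1}^K (1 − u_k(a,w)) ≥ Σ_{k=1}^K (1 − u_k(a*, w⁰)). -/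
/-- Let `K < M` be positive integers and `μhat k m ∈ (0,1]` for every player `k` and arm
`m`. For a function `a : Fin K → Fin M` and an attack vector `w : Fin M → Bool`, the
utility is `u a w k = μhat k (a k)` if no other player chooses arm `a k` and
`w (a k) = false`, and `0` otherwise. Let `astar` be an injective function maximizing
`∑ k, μhat k (a k)` over injective functions, and let `w⁰` be the all-`false` vector.
Then for every function `a` and every attack vector `w`:
`∑ k (1 − u a w k) ≥ ∑ k (1 − u astar w⁰ k)`. -/
theorem stmt_12 (K M : ℕ) (hK : 0 < K) (hKM : K < M)
    (μhat : Fin K → Fin M → ℝ) (hμhat : ∀ k m, μhat k m ∈ Set.Ioc (0 : ℝ) 1)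
    (u : (Fin K → Fin M) → (Fin M → Bool) → Fin K → ℝ)
    (hu : ∀ a w k, u a w k =
      if (∀ j, j ≠ k → a j ≠ a k) ∧ w (a k) = false then μhat k (a k) else 0)
    (astar : Fin K → Fin M) (hinj : Function.Injective astar)
    (hopt : ∀ a : Fin K → Fin M, Function.Injective a →
      ∑ k, μhat k (a k) ≤ ∑ k, μhat k (astar k)) :
    ∀ (a : Fin K → Fin M) (w : Fin M → Bool),
      ∑ k, (1 - u astar (fun _ => false) k) ≤ ∑ k, (1 - u a w k) := by
  intro a w
  classical
  let s : Finset (Fin K) := Finset.univ.filter (fun k => ∀ j, j ≠ k → a j ≠ a k)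
  have hs : ∀ k, k ∈ s ↔ ∀ j, j ≠ k → a j ≠ a k := by
    intro k
    simp [s]
  have hfs : Set.InjOn a (s : Set (Fin K)) := by
    intro x hx y hy hxy
    by_contra hne
    exact (hs y).1 hy x hne hxy
  have hc : (s.image a).card ≤ K := by
    refine Finset.card_image_le.trans ?_
    simpa using Finset.card_le_univ s
  obtain ⟨t, hst, ht⟩ := Finset.exists_superset_card_eq hc (by simpa using hKM.le)
  obtain ⟨g, hg⟩ := Finset.exists_equiv_extend_of_card_eq (by simpa using ht.symm) hst hfs
  have h1 := hopt (fun k => (g k : Fin M)) (fun x y h => g.injective (Subtype.ext h))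
  have h2 : ∑ k, u a w k ≤ ∑ k, μhat k (g k : Fin M) := by
    refine Finset.sum_le_sum fun k _ => ?_
    rw [hu]
    split_ifs with h
    · rw [hg k ((hs k).2 h.1)]
    · exact (hμhat _ _).1.le
  have h3 : ∑ k, u astar (fun _ => false) k = ∑ k, μhat k (astar k) := by
    refine Finset.sum_congr rfl fun k _ => ?_
    rw [hu, if_pos]
    exact ⟨fun j hj h => hj (hinj h), rfl⟩
  rw [Finset.sum_sub_distrib, Finset.sum_sub_distrib, h3]
  linarith
end
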